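/- arXiv:1305.7207 — 3 statements merged into one kernel-verified Lean document; each statement's English description precedes it below -/
import Mathlib

section
/- For integers k,m,r ≥ 1 with 1/k + 1/m + 1/r ≤ 1, if P, Q, R ∈ ℂ[X₁,…,Xₙ] are multivariate polynomials satisfying P^k + Q^m = R^r, then either P, Q, R are all constant or they have a common irreducible factor. -/
open MvPolynomial

/-- Gauss: relatively prime polynomials over a UFD are coprime over its fraction field. -/
theorem isCoprime_map_of_isRelPrime {D : Type*} [CommRing D] [IsDomain D]
    [UniqueFactorizationMonoid D] {f g : Polynomial D} (hf : f ≠ 0) (h : IsRelPrime f g) :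
    IsCoprime (f.map (algebraMap D (FractionRing D))) (g.map (algebraMap D (FractionRing D))) := by
  classical
  letI : NormalizedGCDMonoid D := Nonempty.some inferInstance
  have hinj : Function.Injective (algebraMap D (FractionRing D)) := IsFractionRing.injective _ _
  refine isCoprime_of_irreducible_dvd ?_ ?_
  · rintro ⟨h1, -⟩
    exact hf ((Polynomial.map_eq_zero_iff hinj).1 h1)
  · intro z hz hzf hzg
    set N := IsLocalization.integerNormalization (nonZeroDivisors D) z with hN
    obtain ⟨b, hb0, hb⟩ := IsLocalization.integerNormalization_spec (nonZeroDivisors D) z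
    have hbne : algebraMap D (FractionRing D) b ≠ 0 := by
      intro h0
      exact nonZeroDivisors.ne_zero hb0 (hinj (by rw [h0, map_zero]))
    have hdvd : N.primPart.map (algebraMap D (FractionRing D)) ∣ z := by
      have h1 : N.primPart.map (algebraMap D (FractionRing D)) ∣
          N.map (algebraMap D (FractionRing D)) :=
        Polynomial.map_dvd _ N.primPart_dvd
      rw [hN, hb, Algebra.smul_def, Polynomial.algebraMap_apply] at h1
      exact ((Polynomial.isUnit_C.2 hbne.isUnit).dvd_mul_left).1 h1
    have hu : IsUnit N.primPart := h
      (N.isPrimitive_primPart.dvd_of_fraction_map_dvd_fraction_map (hdvd.trans hzf))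
      (N.isPrimitive_primPart.dvd_of_fraction_map_dvd_fraction_map (hdvd.trans hzg))
    exact hz.not_isUnit
      (Polynomial.isUnit_or_eq_zero_of_isUnit_integerNormalization_primPart hz.ne_zero hu)

/-- The case of polynomials over a UFD of characteristic zero. -/
theorem catalan_ufd {D : Type*} [CommRing D] [IsDomain D] [CharZero D]
    [UniqueFactorizationMonoid D] {k m r : ℕ} (hk : k ≠ 0) (hm : m ≠ 0) (hr : r ≠ 0)
    (hineq : m * r + r * k + k * m ≤ k * m * r)
    {f g h : Polynomial D} (hf : f ≠ 0) (hg : g ≠ 0) (hh : h ≠ 0) (hrel : IsRelPrime f g)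
    (heq : f ^ k + g ^ m = h ^ r) :
    f.natDegree = 0 ∧ g.natDegree = 0 ∧ h.natDegree = 0 := by
  have hinj : Function.Injective (algebraMap D (FractionRing D)) := IsFractionRing.injective _ _
  haveI : CharZero (FractionRing D) := charZero_of_injective_algebraMap hinj
  have key := Polynomial.flt_catalan (k := FractionRing D) hk hm hr hineq
    (Nat.cast_ne_zero.2 hk) (Nat.cast_ne_zero.2 hm) (Nat.cast_ne_zero.2 hr)
    (mt (Polynomial.map_eq_zero_iff hinj).1 hf) (mt (Polynomial.map_eq_zero_iff hinj).1 hg)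
    (mt (Polynomial.map_eq_zero_iff hinj).1 hh) (isCoprime_map_of_isRelPrime hf hrel)
    (u := 1) (v := 1) (w := -1) one_ne_zero one_ne_zero (neg_ne_zero.2 one_ne_zero) (by
      simp only [← Polynomial.map_pow, ← heq]
      simp)
  simpa only [Polynomial.natDegree_map_eq_of_injective hinj] using key

theorem totalDegree_of_isUnit {n : ℕ} {P : MvPolynomial (Fin n) ℂ} (h : IsUnit P) :
    P.totalDegree = 0 :=
  (isUnit_iff_totalDegree_of_isReduced.1 h).2

/-- If `A ^ a` and `B ^ b` are associated and `A`, `B` have no common irreducible factor then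
both are constant. -/
theorem const_of_associated_pow {n : ℕ} {a b : ℕ} (ha : a ≠ 0) (hb : b ≠ 0)
    {A B : MvPolynomial (Fin n) ℂ} (h : Associated (A ^ a) (B ^ b))
    (hno : ∀ q : MvPolynomial (Fin n) ℂ, Irreducible q → q ∣ A → ¬ q ∣ B) :
    A.totalDegree = 0 ∧ B.totalDegree = 0 := by
  by_cases hA : A = 0
  · subst hA
    rw [zero_pow ha, Associated.comm, associated_zero_iff_eq_zero] at h
    rw [eq_zero_of_pow_eq_zero h]
    simp
  have hu : IsUnit A := by
    by_contra hnu
    obtain ⟨q, hq, hqA⟩ := WfDvdMonoid.exists_irreducible_factor hnu hA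
    exact hno q hq hqA (hq.prime.dvd_of_dvd_pow ((dvd_pow hqA ha).trans h.dvd))
  have hu' : IsUnit B := (isUnit_pow_iff hb).1 (h.isUnit (hu.pow a))
  exact ⟨totalDegree_of_isUnit hu, totalDegree_of_isUnit hu'⟩

/-- Multivariate Mason–Stothers corollary: if `1/k + 1/m + 1/r ≤ 1` and `P^k + Q^m = R^r` with
`P, Q, R ∈ ℂ[X₁,…,Xₙ]`, then either `P, Q, R` are all constant or they have a common
irreducible factor. -/
theorem masonStothers_corollary_multivariate (n : ℕ) (k m r : ℕ)
    (hk : 1 ≤ k) (hm : 1 ≤ m) (hr : 1 ≤ r)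
    (habc : (1 : ℚ) / k + 1 / m + 1 / r ≤ 1)
    (P Q R : MvPolynomial (Fin n) ℂ) (heq : P ^ k + Q ^ m = R ^ r) :
    (P.totalDegree = 0 ∧ Q.totalDegree = 0 ∧ R.totalDegree = 0) ∨
      ∃ q : MvPolynomial (Fin n) ℂ, Irreducible q ∧ q ∣ P ∧ q ∣ Q ∧ q ∣ R := by
  have hk0 : k ≠ 0 := by omega
  have hm0 : m ≠ 0 := by omega
  have hr0 : r ≠ 0 := by omega
  refine or_iff_not_imp_right.2 fun hno => ?_
  push Not at hno
  have hineq : m * r + r * k + k * m ≤ k * m * r := by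
    have h1 : (0 : ℚ) < k := by exact_mod_cast hk
    have h2 : (0 : ℚ) < m := by exact_mod_cast hm
    have h3 : (0 : ℚ) < r := by exact_mod_cast hr
    have h4 : ((1 : ℚ) / k + 1 / m + 1 / r) * (k * m * r) ≤ 1 * (k * m * r) :=
      mul_le_mul_of_nonneg_right habc (by positivity)
    have h5 : ((1 : ℚ) / k + 1 / m + 1 / r) * (k * m * r) = m * r + r * k + k * m := by
      field_simp
    rw [h5, one_mul] at h4
    exact_mod_cast h4
  by_cases hP : P = 0
  · subst hP
    rw [zero_pow hk0, zero_add] at heq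
    have := const_of_associated_pow hm0 hr0 (A := Q) (B := R) (by rw [heq])
      (fun q hq h => hno q hq (dvd_zero q) h)
    exact ⟨totalDegree_zero, this⟩
  by_cases hQ : Q = 0
  · subst hQ
    rw [zero_pow hm0, add_zero] at heq
    have := const_of_associated_pow hk0 hr0 (A := P) (B := R) (by rw [heq])
      (fun q hq h => hno q hq h (dvd_zero q))
    exact ⟨this.1, totalDegree_zero, this.2⟩
  by_cases hR : R = 0
  · subst hR
    rw [zero_pow hr0] at heq
    have := const_of_associated_pow hk0 hm0 (A := P) (B := Q)
      (by rw [eq_neg_of_add_eq_zero_left heq]; exact (Associated.refl _).neg_left)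
      (fun q hq h h' => hno q hq h h' (dvd_zero q))
    exact ⟨this.1, this.2, totalDegree_zero⟩
  have hrel : IsRelPrime P Q := by
    refine WfDvdMonoid.isRelPrime_of_no_irreducible_factors (fun h => hP h.1) ?_
    intro q hq h1 h2
    refine hno q hq h1 h2 (hq.prime.dvd_of_dvd_pow (n := r) ?_)
    rw [← heq]
    exact dvd_add (dvd_pow h1 hk0) (dvd_pow h2 hm0)
  have hdeg : ∀ i, P.degreeOf i = 0 ∧ Q.degreeOf i = 0 ∧ R.degreeOf i = 0 := by
    intro i
    let e : MvPolynomial (Fin n) ℂ ≃ₐ[ℂ] Polynomial (MvPolynomial {j // j ≠ i} ℂ) :=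
      (renameEquiv ℂ (Equiv.optionSubtypeNe i).symm).trans (optionEquivLeft ℂ {j // j ≠ i})
    have he : ∀ p, p.degreeOf i = (e p).natDegree := fun p => degreeOf_eq_natDegree i p
    have hne : ∀ {p}, p ≠ 0 → e p ≠ 0 := fun hp => (map_ne_zero_iff e e.injective).2 hp
    rw [he, he, he]
    refine catalan_ufd hk0 hm0 hr0 hineq (hne hP) (hne hQ) (hne hR) ?_ ?_
    · intro d h1 h2
      have h3 : IsUnit (e.symm d) := hrel
        (by simpa using map_dvd e.symm h1) (by simpa using map_dvd e.symm h2)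
      simpa using h3.map e
    · rw [← map_pow, ← map_pow, ← map_pow, ← map_add, heq]
  have htot : ∀ p : MvPolynomial (Fin n) ℂ, (∀ i, p.degreeOf i = 0) → p.totalDegree = 0 := by
    intro p hp
    rw [totalDegree_eq_zero_iff]
    intro d hd i
    have := monomial_le_degreeOf i hd
    rw [hp i] at this
    omega
  exact ⟨htot P fun i => (hdeg i).1, htot Q fun i => (hdeg i).2.1, htot R fun i => (hdeg i).2.2⟩
end

section
/- Fix n ≥ 1. The number of points ω ∈ ℚⁿ with H(ω) ≤ B is asymptotic to (2B)^{n+1}/(2·ζ(n+1)) as B → ∞, where H(ω) = max_i|ν_i| for the coprime integer vector (ν₀,…,νₙ) representing [1:ω₁:…:ωₙ], and ζ is the Riemann zeta function. -/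
open Finset

/-- The integer `H(ω)` for `ω ∈ ℚⁿ`, the maximum absolute value of the coprime integer
coordinates of `[1 : ω₁ : ⋯ : ωₙ]`. -/
def projHeightZ {n : ℕ} (ω : Fin n → ℚ) : ℤ :=
  max ((Finset.univ : Finset (Fin n)).lcm fun i => ((ω i).den : ℤ))
    (((Finset.univ : Finset (Fin n)).sup fun i =>
      (ω i * (((Finset.univ : Finset (Fin n)).lcm fun j => ((ω j).den : ℤ) : ℤ) : ℚ)).num.natAbs : ℕ) : ℤ)


theorem aux_den_dvd (x : ℚ) (L : ℤ) (m : ℤ) (h : x * L = m) (hL : L ≠ 0) : (x.den : ℤ) ∣ L := by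
  have hx : x = (m : ℚ) / (L : ℚ) := by
    rw [← h]; field_simp
  rw [hx]
  rw [← Rat.divInt_eq_div]
  exact Rat.den_dvd m L

theorem aux_int_of_den_dvd (x : ℚ) (L : ℤ) (h : (x.den : ℤ) ∣ L) :
    x * L = ((x * L).num : ℚ) := by
  obtain ⟨k, rfl⟩ := h
  have : x * ((x.den * k : ℤ) : ℚ) = ((x.num * k : ℤ) : ℚ) := by
    push_cast
    rw [← mul_assoc, Rat.mul_den_eq_num]
  rw [this, Rat.num_intCast]

/-- coprimality -/
def auxCop {n : ℕ} (p : ℕ × (Fin n → ℤ)) : Prop :=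
  ∀ d : ℕ, d ∣ p.1 → (∀ i, (d : ℤ) ∣ p.2 i) → d = 1

/-- point -/
def auxPt {n : ℕ} (p : ℕ × (Fin n → ℤ)) : Fin n → ℚ := fun i => (p.2 i : ℚ) / (p.1 : ℚ)

theorem aux_lcm {n : ℕ} (p : ℕ × (Fin n → ℤ)) (h0 : 0 < p.1) (hc : auxCop p) :
    ((Finset.univ : Finset (Fin n)).lcm fun i => ((auxPt p i).den : ℤ)) = (p.1 : ℤ) := by
  have hq : (p.1 : ℚ) ≠ 0 := by positivity
  set L := ((Finset.univ : Finset (Fin n)).lcm fun i => ((auxPt p i).den : ℤ)) with hL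
  have h1 : L ∣ (p.1 : ℤ) := by
    apply Finset.lcm_dvd
    intro i _
    apply aux_den_dvd _ _ (p.2 i)
    · simp only [auxPt]; push_cast; field_simp
    · exact_mod_cast h0.ne'
  have hn : 0 ≤ L := by
    have : normalize L = L := Finset.normalize_lcm
    rw [← this, ← Int.abs_eq_normalize]; positivity
  obtain ⟨k, hk⟩ := h1
  have hLpos : 0 < L := by
    rcases hn.lt_or_eq with h | h
    · exact h
    · rw [← h] at hk; simp at hk; omega
  have hkpos : 0 < k := by
    have : 0 < L * k := by rw [← hk]; exact_mod_cast h0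
    exact pos_of_mul_pos_right this hn
  have hk1 : k.natAbs = 1 := by
    apply hc
    · rw [← Int.natCast_dvd_natCast, hk, Int.natCast_natAbs, abs_of_pos hkpos]
      exact dvd_mul_left _ _
    · intro i
      rw [Int.natCast_natAbs, abs_of_pos hkpos]
      have h2 := aux_int_of_den_dvd (auxPt p i) L (Finset.dvd_lcm (f := fun i => ((auxPt p i).den : ℤ)) (Finset.mem_univ i))
      refine ⟨(auxPt p i * L).num, ?_⟩
      have hk' : (p.1 : ℚ) = L * k := by exact_mod_cast hk
      have h3 : (p.2 i : ℚ) = k * ((auxPt p i * L).num : ℚ) := by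
        rw [← h2]
        simp only [auxPt]
        have : (L : ℚ) ≠ 0 := by exact_mod_cast hLpos.ne'
        have : (k : ℚ) ≠ 0 := by exact_mod_cast hkpos.ne'
        rw [hk']; field_simp
      exact_mod_cast h3
  have : k = 1 := by omega
  rw [hk, this, mul_one]

theorem aux_mul {n : ℕ} (p : ℕ × (Fin n → ℤ)) (h0 : 0 < p.1) (i : Fin n) :
    (auxPt p i * ((p.1 : ℤ) : ℚ)) = (p.2 i : ℚ) := by
  have hq : (p.1 : ℚ) ≠ 0 := by positivity
  simp only [auxPt]; push_cast; field_simp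

theorem aux_height {n : ℕ} (p : ℕ × (Fin n → ℤ)) (h0 : 0 < p.1) (hc : auxCop p) (B : ℕ) :
    projHeightZ (auxPt p) ≤ (B : ℤ) ↔ p.1 ≤ B ∧ ∀ i, (p.2 i).natAbs ≤ B := by
  unfold projHeightZ
  rw [aux_lcm p h0 hc, max_le_iff]
  simp_rw [aux_mul p h0, Rat.num_intCast]
  norm_cast
  simp

open Classical in
/-- box -/
noncomputable def auxBox (n B : ℕ) : Finset (ℕ × (Fin n → ℤ)) :=
  Finset.Icc 1 B ×ˢ Fintype.piFinset (fun _ => Finset.Icc (-(B : ℤ)) B)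

theorem aux_mem_box {n B : ℕ} (p : ℕ × (Fin n → ℤ)) :
    p ∈ auxBox n B ↔ 0 < p.1 ∧ p.1 ≤ B ∧ ∀ i, (p.2 i).natAbs ≤ B := by
  simp only [auxBox, Finset.mem_product, Finset.mem_Icc, Fintype.mem_piFinset, and_assoc]
  refine and_congr Iff.rfl (and_congr Iff.rfl (forall_congr' fun i => ?_))
  omega

theorem aux_surj {n : ℕ} (ω : Fin n → ℚ) : ∃ p : ℕ × (Fin n → ℤ), 0 < p.1 ∧ auxCop p ∧ auxPt p = ω := by
  set L : ℤ := ((Finset.univ : Finset (Fin n)).lcm fun i => ((ω i).den : ℤ)) with hL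
  have hn : 0 ≤ L := by
    have : normalize L = L := Finset.normalize_lcm
    rw [← this, ← Int.abs_eq_normalize]; positivity
  have hne : L ≠ 0 := by
    rw [hL, Ne, Finset.lcm_eq_zero_iff]
    simp
  have hLn : (L.natAbs : ℤ) = L := by omega
  have hw : ∀ i, ω i * L = ((ω i * L).num : ℚ) := fun i =>
    aux_int_of_den_dvd _ _ (Finset.dvd_lcm (f := fun i => ((ω i).den : ℤ)) (Finset.mem_univ i))
  have hLq : (L : ℚ) ≠ 0 := by exact_mod_cast hne
  refine ⟨(L.natAbs, fun i => (ω i * L).num), by simp; omega, ?_, ?_⟩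
  · intro d hd hdi
    simp only at hd hdi
    have hd' : (d : ℤ) ∣ L := by rw [← hLn]; exact_mod_cast hd
    obtain ⟨k, hk⟩ := hd'
    have hk0 : k ≠ 0 := by rintro rfl; simp at hk; exact hne hk
    have hd0 : (d : ℤ) ≠ 0 := by rintro h; rw [h] at hk; simp at hk; exact hne hk
    have : L ∣ k := by
      apply Finset.lcm_dvd
      intro i _
      obtain ⟨m, hm⟩ := hdi i
      apply aux_den_dvd _ _ m _ hk0
      have h := hw i
      rw [hm, hk] at h
      push_cast at h
      have hdq : (d : ℚ) ≠ 0 := by exact_mod_cast hd0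
      apply mul_left_cancel₀ hdq
      linarith
    obtain ⟨j, hj⟩ := this
    have : (d : ℤ) * j = 1 := by
      apply mul_left_cancel₀ hk0
      calc k * (d * j) = (d * k) * j := by ring
        _ = k * 1 := by rw [← hk, ← hj, mul_one]
    have := Int.eq_one_or_neg_one_of_mul_eq_one this
    omega
  · funext i
    simp only [auxPt]
    rw [← hw i]
    have : ((L.natAbs : ℕ) : ℚ) = (L : ℚ) := by
      rw [← Int.cast_natCast, hLn]
    rw [this]; field_simp

open Classical in
theorem aux_card (n B : ℕ) : Nat.card {ω : Fin n → ℚ // projHeightZ ω ≤ (B : ℤ)} =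
    ((auxBox n B).filter auxCop).card := by
  rw [← Nat.card_eq_finsetCard]
  symm
  have key : ∀ p ∈ (auxBox n B).filter auxCop, 0 < p.1 ∧ auxCop p ∧ projHeightZ (auxPt p) ≤ (B : ℤ) := by
    intro p hp
    rw [Finset.mem_filter, aux_mem_box] at hp
    exact ⟨hp.1.1, hp.2, (aux_height p hp.1.1 hp.2 B).2 hp.1.2⟩
  refine Nat.card_eq_of_bijective
    (fun p : ((auxBox n B).filter auxCop : Finset _) => (⟨auxPt p.1, (key p.1 p.2).2.2⟩ :
      {ω : Fin n → ℚ // projHeightZ ω ≤ (B : ℤ)})) ⟨?_, ?_⟩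
  · rintro ⟨p, hp⟩ ⟨p', hp'⟩ h
    have h : auxPt p = auxPt p' := congrArg Subtype.val h
    obtain ⟨h0, hc, -⟩ := key p hp
    obtain ⟨h0', hc', -⟩ := key p' hp'
    have e1 : p.1 = p'.1 := by
      have := aux_lcm p h0 hc
      rw [h, aux_lcm p' h0' hc'] at this
      exact_mod_cast this.symm
    have e2 : p.2 = p'.2 := by
      funext i
      have := aux_mul p h0 i
      rw [h, e1, aux_mul p' h0' i] at this
      exact_mod_cast this.symm
    exact Subtype.ext (Prod.ext e1 e2)
  · rintro ⟨ω, hω⟩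
    obtain ⟨p, h0, hc, rfl⟩ := aux_surj ω
    refine ⟨⟨p, ?_⟩, rfl⟩
    rw [Finset.mem_filter, aux_mem_box]
    exact ⟨⟨h0, (aux_height p h0 hc B).1 hω⟩, hc⟩

theorem aux_int_count (B d : ℕ) (hd : 0 < d) :
    ((Finset.Icc (-(B : ℤ)) B).filter fun x => (d : ℤ) ∣ x).card = 2 * (B / d) + 1 := by
  have : ((Finset.Icc (-(B : ℤ)) B).filter fun x => (d : ℤ) ∣ x) =
      (Finset.Icc (-((B / d : ℕ) : ℤ)) ((B / d : ℕ) : ℤ)).image (fun x => (d : ℤ) * x) := by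
    ext x
    have hd' : (0 : ℤ) < d := by exact_mod_cast hd
    simp only [Finset.mem_filter, Finset.mem_Icc, Finset.mem_image]
    have h2 : ∀ k : ℤ, k ≤ ((B / d : ℕ) : ℤ) ↔ d * k ≤ B := by
      intro k
      push_cast
      rw [Int.le_ediv_iff_mul_le hd', mul_comm]
    constructor
    · rintro ⟨⟨h1, h3⟩, k, rfl⟩
      refine ⟨k, ⟨?_, (h2 k).2 h3⟩, rfl⟩
      have := (h2 (-k)).2 (by linarith)
      linarith
    · rintro ⟨k, ⟨h1, h3⟩, rfl⟩
      have := (h2 (-k)).1 (by linarith)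
      exact ⟨⟨by linarith, (h2 k).1 h3⟩, dvd_mul_right _ _⟩
  rw [this, Finset.card_image_of_injective]
  · rw [Int.card_Icc]; omega
  · intro a b h
    have hd' : (d : ℤ) ≠ 0 := by exact_mod_cast hd.ne'
    exact mul_left_cancel₀ hd' h

theorem aux_box_count (n B d : ℕ) (hd : 0 < d) :
    ((auxBox n B).filter fun p => d ∣ p.1 ∧ ∀ i, (d : ℤ) ∣ p.2 i).card =
      (B / d) * (2 * (B / d) + 1) ^ n := by
  have : ((auxBox n B).filter fun p => d ∣ p.1 ∧ ∀ i, (d : ℤ) ∣ p.2 i) =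
      ((Finset.Ioc 0 B).filter fun x => d ∣ x) ×ˢ
        Fintype.piFinset (fun _ : Fin n => (Finset.Icc (-(B : ℤ)) B).filter fun x => (d : ℤ) ∣ x) := by
    ext p
    simp only [auxBox, Finset.mem_filter, Finset.mem_product, Fintype.mem_piFinset, Finset.mem_Icc,
      Finset.mem_Ioc, forall_and, Nat.succ_le_iff]
    tauto
  rw [this, Finset.card_product, Nat.Ioc_filter_dvd_card_eq_div, Fintype.card_piFinset]
  simp only [aux_int_count B d hd]
  simp

open ArithmeticFunction in
theorem aux_sum_moebius (g : ℕ) : ∑ d ∈ g.divisors, moebius d = if g = 1 then 1 else 0 := by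
  rw [← coe_zeta_mul_apply, coe_zeta_mul_moebius, one_apply]

open ArithmeticFunction Classical in
theorem aux_indicator (n B : ℕ) (p : ℕ × (Fin n → ℤ)) (hp : p ∈ auxBox n B) :
    (if auxCop p then (1 : ℤ) else 0) =
      ∑ d ∈ Finset.Icc 1 B, if (d ∣ p.1 ∧ ∀ i, (d : ℤ) ∣ p.2 i) then moebius d else 0 := by
  rw [aux_mem_box] at hp
  set g := Nat.gcd p.1 (Finset.univ.gcd fun i => (p.2 i).natAbs) with hg
  have hdg : ∀ d : ℕ, d ∣ g ↔ (d ∣ p.1 ∧ ∀ i, (d : ℤ) ∣ p.2 i) := by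
    intro d
    rw [hg, Nat.dvd_gcd_iff, Finset.dvd_gcd_iff]
    simp [Int.natCast_dvd]
  have hgpos : 0 < g := Nat.gcd_pos_of_pos_left _ hp.1
  have hcop : auxCop p ↔ g = 1 := by
    constructor
    · intro h
      have := (hdg g).1 dvd_rfl
      exact h g this.1 this.2
    · intro h d h1 h2
      have := (hdg d).2 ⟨h1, h2⟩
      rw [h] at this
      exact Nat.dvd_one.1 this
  rw [← Finset.sum_filter, if_congr hcop rfl rfl, ← aux_sum_moebius]
  apply Finset.sum_congr _ (fun _ _ => rfl)
  ext d
  rw [Nat.mem_divisors, Finset.mem_filter, Finset.mem_Icc, ← hdg]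
  constructor
  · rintro ⟨h, -⟩
    have h1 := ((hdg d).1 h).1
    exact ⟨⟨Nat.pos_of_dvd_of_pos h1 hp.1, (Nat.le_of_dvd hp.1 h1).trans hp.2.1⟩, h⟩
  · rintro ⟨-, h⟩
    exact ⟨h, hgpos.ne'⟩

open ArithmeticFunction Classical in
theorem aux_card_eq (n B : ℕ) :
    (Nat.card {ω : Fin n → ℚ // projHeightZ ω ≤ (B : ℤ)} : ℤ) =
      ∑ d ∈ Finset.Icc 1 B, moebius d * (((B / d) * (2 * (B / d) + 1) ^ n : ℕ) : ℤ) := by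
  rw [aux_card, Finset.card_filter, Nat.cast_sum]
  simp only [Nat.cast_ite, Nat.cast_one, Nat.cast_zero]
  rw [Finset.sum_congr rfl (fun p hp => aux_indicator n B p hp), Finset.sum_comm]
  apply Finset.sum_congr rfl
  intro d hd
  rw [← aux_box_count n B d (Finset.mem_Icc.1 hd).1, ← Finset.sum_filter, Finset.sum_const, nsmul_eq_mul, mul_comm]

open ArithmeticFunction in
theorem aux_zeta (s : ℕ) (hs : 1 < s) :
    (∑' k : ℕ, (1 : ℝ) / (k + 1) ^ s) * (∑' d : ℕ, (moebius d : ℝ) / (d : ℝ) ^ s) = 1 := by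
  have hs' : 1 < ((s : ℕ) : ℂ).re := by simpa using hs
  have h := LSeries_zeta_mul_Lseries_moebius hs'
  rw [LSeries_zeta_eq_riemannZeta hs', zeta_eq_tsum_one_div_nat_add_one_cpow hs', LSeries] at h
  apply Complex.ofReal_injective
  push_cast [Complex.ofReal_tsum]
  refine Eq.trans ?_ h
  congr 1
  · apply tsum_congr
    intro k
    rw [Complex.cpow_natCast]
  · apply tsum_congr
    intro d
    rw [LSeries.term_def]
    split_ifs with h0
    · simp [h0]
    · rw [Complex.cpow_natCast]

open ArithmeticFunction in
theorem aux_main (n : ℕ) (hn : 1 ≤ n) :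
    Filter.Tendsto (fun B : ℕ => ∑' d : ℕ,
      ((moebius d : ℝ) * (((B / d : ℕ) : ℝ) * (2 * ((B / d : ℕ) : ℝ) + 1) ^ n) / (2 * (B : ℝ)) ^ (n + 1)))
      Filter.atTop (nhds (∑' d : ℕ, (1 / 2 : ℝ) * ((moebius d : ℝ) / (d : ℝ) ^ (n + 1)))) := by
  apply tendsto_tsum_of_dominated_convergence (bound := fun d : ℕ => 3 ^ n * (1 / (d : ℝ) ^ (n + 1)))
  · exact (Real.summable_one_div_nat_pow.2 (by omega)).mul_left _
  · intro d
    rcases Nat.eq_zero_or_pos d with rfl | hd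
    · simp
    have h1 : Filter.Tendsto (fun B : ℕ => ((B / d : ℕ) : ℝ) / (B : ℝ)) Filter.atTop (nhds (1 / (d : ℝ))) := by
      have := (tendsto_nat_floor_mul_div_atTop (R := ℝ) (a := 1 / (d : ℝ)) (by positivity)).comp
        (tendsto_natCast_atTop_atTop (R := ℝ))
      refine this.congr fun B => ?_
      simp only [Function.comp]
      rw [one_div_mul_eq_div, Nat.floor_div_natCast, Nat.floor_natCast]
    have h2 : Filter.Tendsto (fun B : ℕ => 1 / (B : ℝ)) Filter.atTop (nhds 0) :=
      tendsto_one_div_atTop_nhds_zero_nat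
    have h3 := ((h1.mul (((h1.const_mul 2).add h2).pow n)).const_mul (moebius d : ℝ)).div_const (2 ^ (n + 1))
    have hd' : (d : ℝ) ≠ 0 := by positivity
    have e : (moebius d : ℝ) * (1 / (d : ℝ) * (2 * (1 / (d : ℝ)) + 0) ^ n) / 2 ^ (n + 1) =
        (1 / 2 : ℝ) * ((moebius d : ℝ) / (d : ℝ) ^ (n + 1)) := by
      rw [add_zero, mul_one_div, div_pow, pow_succ, pow_succ]
      field_simp
    rw [e] at h3
    refine h3.congr' ?_
    filter_upwards [Filter.eventually_gt_atTop 0] with B hB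
    have hB' : (B : ℝ) ≠ 0 := by positivity
    have : 2 * (((B / d : ℕ) : ℝ) / (B : ℝ)) + 1 / (B : ℝ) = (2 * ((B / d : ℕ) : ℝ) + 1) / B := by
      field_simp
    rw [this, div_pow, mul_pow, pow_succ (B : ℝ)]
    field_simp
  · filter_upwards [Filter.eventually_gt_atTop 0] with B hB d
    have hB' : (0 : ℝ) < B := by positivity
    have hmu : |(moebius d : ℝ)| ≤ 1 := by exact_mod_cast abs_moebius_le_one (n := d)
    rw [Real.norm_eq_abs, abs_div, abs_mul]
    have hx : ((B / d : ℕ) : ℝ) ≤ (B : ℝ) / d := Nat.cast_div_le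
    generalize B / d = m at hx
    rw [abs_of_nonneg (by positivity : (0 : ℝ) ≤ (m : ℝ) * (2 * m + 1) ^ n),
      abs_of_nonneg (by positivity : (0 : ℝ) ≤ (2 * (B : ℝ)) ^ (n + 1)), div_le_iff₀ (by positivity)]
    have hF : (m : ℝ) * (2 * m + 1) ^ n ≤ 3 ^ n * (m : ℝ) ^ (n + 1) := by
      rcases Nat.eq_zero_or_pos m with rfl | hm
      · simp
      have hm' : (1 : ℝ) ≤ m := by exact_mod_cast hm
      calc (m : ℝ) * (2 * m + 1) ^ n ≤ m * (3 * m) ^ n := by gcongr; linarith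
        _ = 3 ^ n * (m : ℝ) ^ (n + 1) := by rw [mul_pow]; ring
    calc |(moebius d : ℝ)| * ((m : ℝ) * (2 * m + 1) ^ n) ≤ 1 * (3 ^ n * (m : ℝ) ^ (n + 1)) := by gcongr
      _ ≤ 1 * (3 ^ n * ((B : ℝ) / d) ^ (n + 1)) := by gcongr
      _ = 3 ^ n * (1 / (d : ℝ) ^ (n + 1)) * (B : ℝ) ^ (n + 1) := by rw [div_pow]; ring
      _ ≤ 3 ^ n * (1 / (d : ℝ) ^ (n + 1)) * (2 * (B : ℝ)) ^ (n + 1) := by gcongr; linarith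

/-- The number of points `ω ∈ ℚⁿ` with `H(ω) ≤ B` is asymptotic to
`(2B)^{n+1} / (2 ζ(n+1))` as `B → ∞`. -/
theorem count_rational_points_asymptotic (n : ℕ) (hn : 1 ≤ n) :
    Filter.Tendsto
      (fun B : ℕ =>
        (Nat.card {ω : Fin n → ℚ // projHeightZ ω ≤ (B : ℤ)} : ℝ) / (2 * (B : ℝ)) ^ (n + 1))
      Filter.atTop
      (nhds (1 / (2 * ∑' k : ℕ, (1 : ℝ) / (k + 1) ^ (n + 1)))) := by
  have hM := aux_main n hn
  have hz := aux_zeta (n + 1) (by omega)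
  rw [tsum_mul_left] at hM
  have hZ : (∑' k : ℕ, (1 : ℝ) / (k + 1) ^ (n + 1)) ≠ 0 := left_ne_zero_of_mul_eq_one hz
  have e : 1 / (2 * ∑' k : ℕ, (1 : ℝ) / (k + 1) ^ (n + 1)) =
      1 / 2 * ∑' d : ℕ, ((ArithmeticFunction.moebius d : ℝ) / (d : ℝ) ^ (n + 1)) := by
    rw [eq_div_of_mul_eq hZ ((mul_comm _ _).trans hz)]
    rw [div_mul_div_comm, one_mul]
  rw [e]
  refine hM.congr fun B => ?_
  have h := congrArg (Int.cast : ℤ → ℝ) (aux_card_eq n B)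
  rw [Int.cast_natCast, Int.cast_sum] at h
  rw [h, tsum_eq_sum (s := Finset.Icc 1 B), Finset.sum_div]
  · apply Finset.sum_congr rfl
    intro d _
    rw [Int.cast_mul, Int.cast_natCast]
    push_cast
    rfl
  intro d hd
  rcases Nat.eq_zero_or_pos d with rfl | hd0
  · simp
  · have : B < d := by
      rw [Finset.mem_Icc] at hd
      omega
    simp [Nat.div_eq_of_lt this]
end

section
/- Let A(T), B(T) ∈ ℤ[T₁,…,Tₙ] and suppose Δ(T) = −16(4A(T)³ + 27B(T)²) is a nonzero constant multiple of a 12th power in ℂ[T₁,…,Tₙ], i.e. Δ = α·R¹² with R ∈ ℂ[T], R ≠ 0. Then there exist constants α₁, α₂ ∈ ℂ such that A = α₁·R⁴ and B = α₂·R⁶. -/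
open Polynomial in
theorem descent_aux (u v w : ℂ) (hu : u ≠ 0) (hv : v ≠ 0) (hw : w ≠ 0) (N : ℕ) :
    ∀ a b s : ℂ[X], s.natDegree ≤ N → s ≠ 0 → C u * a ^ 3 + C v * b ^ 2 + C w * s ^ 6 = 0 →
      ∃ c d : ℂ, a = C c * s ^ 2 ∧ b = C d * s ^ 3 := by
  have hvC : IsUnit (C v) := isUnit_C.2 hv.isUnit
  have huC : IsUnit (C u) := isUnit_C.2 hu.isUnit
  have hwC : IsUnit (C w) := isUnit_C.2 hw.isUnit
  induction N with
  | zero =>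
    intro a b s hs hs0 h
    obtain ⟨σ, rfl⟩ : ∃ σ, s = C σ := ⟨_, eq_C_of_natDegree_le_zero hs⟩
    have hσ : σ ≠ 0 := by rintro rfl; simp at hs0
    suffices hh : a.natDegree = 0 ∧ b.natDegree = 0 by
      rw [eq_C_of_natDegree_eq_zero hh.1, eq_C_of_natDegree_eq_zero hh.2]
      refine ⟨a.coeff 0 / σ ^ 2, b.coeff 0 / σ ^ 3, ?_, ?_⟩
      · rw [← C_pow, ← C_mul]; congr 1; field_simp
      · rw [← C_pow, ← C_mul]; congr 1; field_simp
    by_cases ha : a = 0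
    · subst ha
      refine ⟨by simp, ?_⟩
      have h2 : C v * b ^ 2 = C (- (w * σ ^ 6)) := by
        simp only [C_neg, C_mul, C_pow]; linear_combination h
      have := congrArg natDegree h2
      rw [natDegree_C_mul hv, natDegree_pow, natDegree_C] at this
      omega
    by_cases hb : b = 0
    · subst hb
      refine ⟨?_, by simp⟩
      have h2 : C u * a ^ 3 = C (- (w * σ ^ 6)) := by
        simp only [C_neg, C_mul, C_pow]; linear_combination h
      have := congrArg natDegree h2
      rw [natDegree_C_mul hu, natDegree_pow, natDegree_C] at this
      omega
    have hcop : IsCoprime a b := by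
      refine isCoprime_of_irreducible_dvd (by tauto) ?_
      rintro z hz ⟨a', rfl⟩ ⟨b', rfl⟩
      have h1 : z ∣ C w * C σ ^ 6 :=
        ⟨-(C u * z ^ 2 * a' ^ 3 + C v * z * b' ^ 2), by linear_combination h⟩
      refine hz.not_isUnit (isUnit_of_dvd_unit h1 (hwC.mul ((isUnit_C.2 hσ.isUnit).pow 6)))
    have := Polynomial.flt_catalan (p := 3) (q := 2) (r := 6) (by norm_num) (by norm_num)
      (by norm_num) (by norm_num) (by norm_num) (by norm_num) (by norm_num) ha hb hs0 hcop
      hu hv hw h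
    exact ⟨this.1, this.2.1⟩
  | succ N ih =>
    intro a b s hs hs0 h
    by_cases hsN : s.natDegree ≤ N
    · exact ih a b s hsN hs0 h
    have key : ∃ z, Irreducible z ∧ z ∣ s ∧ z ∣ a ∧ z ∣ b := by
      by_contra hcon
      push Not at hcon
      by_cases ha : a = 0
      · obtain ⟨z, hz, hzs⟩ := exists_irreducible_of_natDegree_pos (f := s) (by omega)
        refine hcon z hz hzs (by simp [ha]) (hz.prime.dvd_of_dvd_pow (n := 2) ?_)
        rw [← hvC.dvd_mul_left]
        obtain ⟨s', rfl⟩ := hzs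
        exact ⟨-(C w * z ^ 5 * s' ^ 6), by subst ha; linear_combination h⟩
      by_cases hb : b = 0
      · obtain ⟨z, hz, hzs⟩ := exists_irreducible_of_natDegree_pos (f := s) (by omega)
        refine hcon z hz hzs (hz.prime.dvd_of_dvd_pow (n := 3) ?_) (by simp [hb])
        rw [← huC.dvd_mul_left]
        obtain ⟨s', rfl⟩ := hzs
        exact ⟨-(C w * z ^ 5 * s' ^ 6), by subst hb; linear_combination h⟩
      have hcop : IsCoprime a b := by
        refine isCoprime_of_irreducible_dvd (by tauto) ?_
        intro z hz hza hzb
        refine hcon z hz (hz.prime.dvd_of_dvd_pow (n := 6) ?_) hza hzb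
        rw [← hwC.dvd_mul_left]
        obtain ⟨a', rfl⟩ := hza
        obtain ⟨b', rfl⟩ := hzb
        exact ⟨-(C u * z ^ 2 * a' ^ 3 + C v * z * b' ^ 2), by linear_combination h⟩
      have := Polynomial.flt_catalan (p := 3) (q := 2) (r := 6) (by norm_num) (by norm_num)
        (by norm_num) (by norm_num) (by norm_num) (by norm_num) (by norm_num) ha hb hs0 hcop
        hu hv hw h
      omega
    obtain ⟨z, hz, ⟨s, rfl⟩, ⟨a, rfl⟩, ⟨b, rfl⟩⟩ := key
    have hz0 := hz.ne_zero
    have hb : z ∣ b := by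
      refine hz.prime.dvd_of_dvd_pow (n := 2) ?_
      rw [← hvC.dvd_mul_left]
      refine ⟨-(C u * a ^ 3 + C w * z ^ 3 * s ^ 6), mul_left_cancel₀ (pow_ne_zero 2 hz0) ?_⟩
      linear_combination h
    obtain ⟨b, rfl⟩ := hb
    have ha : z ∣ a := by
      refine hz.prime.dvd_of_dvd_pow (n := 3) ?_
      rw [← huC.dvd_mul_left]
      refine ⟨-(C v * b ^ 2 + C w * z ^ 2 * s ^ 6), mul_left_cancel₀ (pow_ne_zero 3 hz0) ?_⟩
      linear_combination h
    obtain ⟨a, rfl⟩ := ha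
    have hb : z ∣ b := by
      refine hz.prime.dvd_of_dvd_pow (n := 2) ?_
      rw [← hvC.dvd_mul_left]
      refine ⟨-(C u * z * a ^ 3 + C w * z * s ^ 6), mul_left_cancel₀ (pow_ne_zero 4 hz0) ?_⟩
      linear_combination h
    obtain ⟨b, rfl⟩ := hb
    have hs1 : s ≠ 0 := right_ne_zero_of_mul hs0
    have hd := natDegree_mul hz0 hs1
    have hzd := hz.natDegree_pos
    obtain ⟨c, d, h1, h2⟩ := ih a b s (by omega) hs1
      (mul_left_cancel₀ (pow_ne_zero 6 hz0) (by linear_combination h))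
    refine ⟨c, d, ?_, ?_⟩
    · rw [h1]; ring
    · rw [h2]; ring


/-- If `Δ = -16(4A³ + 27B²)` is a nonzero constant multiple of a twelfth power in
`ℂ[T₁,…,Tₙ]`, say `Δ = α R¹²` with `R ≠ 0`, then `A = α₁ R⁴` and `B = α₂ R⁶` for
some constants `α₁, α₂ ∈ ℂ`. -/
theorem discriminant_twelfth_power (n : ℕ) (A B : MvPolynomial (Fin n) ℤ)
    (α : ℂ) (hα : α ≠ 0) (R : MvPolynomial (Fin n) ℂ) (hR : R ≠ 0)
    (h : MvPolynomial.map (Int.castRingHom ℂ) (-16 * (4 * A ^ 3 + 27 * B ^ 2))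
      = MvPolynomial.C α * R ^ 12) :
    ∃ α₁ α₂ : ℂ,
      MvPolynomial.map (Int.castRingHom ℂ) A = MvPolynomial.C α₁ * R ^ 4 ∧
        MvPolynomial.map (Int.castRingHom ℂ) B = MvPolynomial.C α₂ * R ^ 6 := by
  set A' := MvPolynomial.map (Int.castRingHom ℂ) A with hA'
  set B' := MvPolynomial.map (Int.castRingHom ℂ) B with hB'
  have h' : MvPolynomial.C (-64) * A' ^ 3 + MvPolynomial.C (-432) * B' ^ 2
      + MvPolynomial.C (-α) * (R ^ 2) ^ 6 = 0 := by
    simp only [map_mul, map_add, map_pow, map_neg, map_ofNat, ← hA', ← hB'] at h ⊢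
    linear_combination h
  obtain ⟨p, hp⟩ : ∃ p, MvPolynomial.eval p R ≠ 0 := by
    by_contra hcon
    push Not at hcon
    exact hR (MvPolynomial.funext (by simpa using hcon))
  -- restrict to the line through `p` and `q`
  have key : ∀ q, ∃ c d : ℂ,
      (MvPolynomial.eval p A' = c * MvPolynomial.eval p R ^ 4 ∧
        MvPolynomial.eval p B' = d * MvPolynomial.eval p R ^ 6) ∧
      (MvPolynomial.eval q A' = c * MvPolynomial.eval q R ^ 4 ∧
        MvPolynomial.eval q B' = d * MvPolynomial.eval q R ^ 6) := by
    intro q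
    let φ : MvPolynomial (Fin n) ℂ →ₐ[ℂ] Polynomial ℂ := MvPolynomial.aeval
      (fun i => Polynomial.C (p i) + Polynomial.X * Polynomial.C (q i - p i))
    have hC : ∀ x, φ (MvPolynomial.C x) = Polynomial.C x := fun x => φ.commutes x
    have e0 : ∀ P, (φ P).eval 0 = MvPolynomial.eval p P := by
      intro P
      have : ((Polynomial.evalRingHom 0).comp φ.toRingHom) = MvPolynomial.eval p := by
        apply MvPolynomial.ringHom_ext
        · intro r; simp [hC]
        · intro i; simp [φ]
      exact congrArg (fun f => f P) this
    have e1 : ∀ P, (φ P).eval 1 = MvPolynomial.eval q P := by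
      intro P
      have : ((Polynomial.evalRingHom 1).comp φ.toRingHom) = MvPolynomial.eval q := by
        apply MvPolynomial.ringHom_ext
        · intro r; simp [hC]
        · intro i; simp [φ]
      exact congrArg (fun f => f P) this
    have hφR : φ R ^ 2 ≠ 0 := by
      refine pow_ne_zero 2 fun h0 => hp ?_
      rw [← e0, h0, Polynomial.eval_zero]
    have hφ := congrArg φ h'
    rw [map_add, map_add, map_mul, map_mul, map_mul, hC, hC, hC, map_pow, map_pow, map_pow,
      map_pow, map_zero] at hφ
    obtain ⟨c, d, h1, h2⟩ := descent_aux (-64) (-432) (-α) (by norm_num) (by norm_num)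
      (neg_ne_zero.2 hα) _ _ _ _ le_rfl hφR hφ
    refine ⟨c, d, ⟨?_, ?_⟩, ?_, ?_⟩
    · rw [← e0, ← e0, h1]; simp only [Polynomial.eval_mul, Polynomial.eval_pow, Polynomial.eval_C]; ring
    · rw [← e0, ← e0, h2]; simp only [Polynomial.eval_mul, Polynomial.eval_pow, Polynomial.eval_C]; ring
    · rw [← e1, ← e1, h1]; simp only [Polynomial.eval_mul, Polynomial.eval_pow, Polynomial.eval_C]; ring
    · rw [← e1, ← e1, h2]; simp only [Polynomial.eval_mul, Polynomial.eval_pow, Polynomial.eval_C]; ring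
  refine ⟨MvPolynomial.eval p A' / MvPolynomial.eval p R ^ 4,
    MvPolynomial.eval p B' / MvPolynomial.eval p R ^ 6,
    MvPolynomial.funext fun q => ?_, MvPolynomial.funext fun q => ?_⟩
  · obtain ⟨c, d, ⟨h1, h2⟩, h3, h4⟩ := key q
    rw [h3, h1, mul_div_cancel_right₀ _ (pow_ne_zero 4 hp)]; simp
  · obtain ⟨c, d, ⟨h1, h2⟩, h3, h4⟩ := key q
    rw [h4, h2, mul_div_cancel_right₀ _ (pow_ne_zero 6 hp)]; simp
end
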